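/- arXiv:2602.01295 — 2 statements merged into one kernel-verified Lean document; each statement's English description precedes it below -/
import Mathlib

section
/- Tsallis power-sum comparison of occupancy measures: let x = ρ^{ℙ,π} be the occupancy measure of any policy π and ρ̊ = ρ^{ℙ,π̊} that of a deterministic policy π̊ in the layered MDP, and let α ∈ (1,2]. Then ∑_{(s,a)} x(s,a)^{1/α} − ∑_{(s,a)} ρ̊(s,a)^{1/α} ≤ (1 + H^{1/α} S^{1 − 1/α}) · ∑_{(s,a): a ≠ π̊(s)} x(s,a)^{1/α}. -/
open Finset MeasureTheory

open scoped Classical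

lemma sum_rpow_le_card_rpow_mul_rpow_sum {ι : Type*} [Fintype ι] {α : ℝ} (hα : 1 ≤ α)
    (y : ι → ℝ) (hy : ∀ i, 0 ≤ y i) :
    ∑ i, y i ^ (1 / α) ≤ (Fintype.card ι : ℝ) ^ (1 - 1 / α) * (∑ i, y i) ^ (1 / α) := by
  have hα0 : 0 < α := by linarith
  have h := Real.rpow_sum_le_const_mul_sum_rpow_of_nonneg Finset.univ (f := fun i => y i ^ (1 / α))
    hα (fun i _ => Real.rpow_nonneg (hy i) _)
  have hpow : ∀ i, (y i ^ (1 / α)) ^ α = y i := fun i => by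
    rw [← Real.rpow_mul (hy i), one_div_mul_cancel hα0.ne', Real.rpow_one]
  simp only [hpow, Finset.card_univ] at h
  have hsum : 0 ≤ ∑ i, y i ^ (1 / α) := Finset.sum_nonneg fun i _ => Real.rpow_nonneg (hy i) _
  have h' := Real.rpow_le_rpow (Real.rpow_nonneg hsum _) h (one_div_pos.2 hα0).le
  rw [← Real.rpow_mul hsum, mul_one_div_cancel hα0.ne', Real.rpow_one,
    Real.mul_rpow (by positivity) (Finset.sum_nonneg fun i _ => hy i),
    ← Real.rpow_mul (by positivity)] at h'
  rwa [show (α - 1) * (1 / α) = 1 - 1 / α by field_simp] at h'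

lemma rpow_sum_le_sum_rpow_of_le_one {ι : Type*} (s : Finset ι) {p : ℝ} (hp : 0 < p) (hp1 : p ≤ 1)
    (y : ι → ℝ) (hy : ∀ i ∈ s, 0 ≤ y i) :
    (∑ i ∈ s, y i) ^ p ≤ ∑ i ∈ s, y i ^ p :=
  Finset.le_sum_of_subadditive_on_pred (fun t : ℝ => t ^ p) (fun t => 0 ≤ t)
    (Real.zero_rpow hp.ne').le (fun _ _ ha hb => Real.rpow_add_le_add_rpow ha hb hp.le hp1)
    (fun _ _ ha hb => add_nonneg ha hb) y hy

lemma rpow_sub_rpow_le_rpow_max_sub {p a b : ℝ} (ha : 0 ≤ a) (hb : 0 ≤ b) (hp : 0 ≤ p)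
    (hp1 : p ≤ 1) : a ^ p - b ^ p ≤ max 0 (a - b) ^ p := by
  have h1 : a ^ p ≤ (max 0 (a - b) + b) ^ p :=
    Real.rpow_le_rpow ha (by linarith [le_max_right 0 (a - b)]) hp
  linarith [Real.rpow_add_le_add_rpow (le_max_left 0 (a - b)) hb hp hp1]

/-- If the mass of `y` in each layer after the first is bounded by an inflow `g` from the previous
layer, and each state `s` emits at most `y s + d s`, then the total mass of `y` is at most
`H * ∑ s, d s`. -/
lemma sum_le_mul_sum_of_layered_flow {S : Type*} [Fintype S] {H : ℕ} {layer : S → ℕ}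
    (hlayer : ∀ s, 1 ≤ layer s ∧ layer s ≤ H) {y d : S → ℝ} {g : S → S → ℝ}
    (hd : ∀ s, 0 ≤ d s) (hy1 : ∀ s, layer s = 1 → y s ≤ 0)
    (hg_supp : ∀ s s', g s s' ≠ 0 → layer s' = layer s + 1)
    (hg_nonneg : ∀ s s', 0 ≤ g s s') (hg_sum : ∀ s, ∑ s', g s s' ≤ y s + d s)
    (hy : ∀ s', 2 ≤ layer s' → y s' ≤ ∑ s, g s s') :
    ∑ s, y s ≤ H * ∑ s, d s := by
  have key : ∀ n, ∑ s, (if layer s = n + 1 then y s else 0) ≤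
      ∑ s, if layer s ≤ n then d s else 0 := by
    intro n
    induction n with
    | zero =>
      refine Finset.sum_le_sum fun s _ => ?_
      have := hlayer s
      rw [if_neg (show ¬ layer s ≤ 0 by omega)]
      split_ifs with h
      exacts [hy1 s h, le_rfl]
    | succ n ih =>
      calc ∑ s', (if layer s' = n + 1 + 1 then y s' else 0)
          ≤ ∑ s', ∑ s, (if layer s = n + 1 then g s s' else 0) := by
            refine Finset.sum_le_sum fun s' _ => ?_
            split_ifs with h
            · refine (hy s' (by omega)).trans (Finset.sum_le_sum fun s _ => ?_)
              split_ifs with h2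
              · exact le_rfl
              · by_contra hne
                have := hg_supp s s' (fun h0 => hne h0.le)
                omega
            · refine Finset.sum_nonneg fun s _ => ?_
              split_ifs
              exacts [hg_nonneg s s', le_rfl]
        _ = ∑ s, (if layer s = n + 1 then ∑ s', g s s' else 0) := by
            rw [Finset.sum_comm]
            refine Finset.sum_congr rfl fun s _ => ?_
            split_ifs <;> simp
        _ ≤ ∑ s, ((if layer s = n + 1 then y s else 0) + if layer s = n + 1 then d s else 0) := by
            refine Finset.sum_le_sum fun s _ => ?_
            split_ifs
            exacts [hg_sum s, by simp]
        _ ≤ ∑ s, (if layer s ≤ n then d s else 0) + ∑ s, if layer s = n + 1 then d s else 0 := by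
            rw [Finset.sum_add_distrib]
            gcongr
        _ = ∑ s, if layer s ≤ n + 1 then d s else 0 := by
            rw [← Finset.sum_add_distrib]
            refine Finset.sum_congr rfl fun s _ => ?_
            split_ifs <;> first | omega | simp
  calc ∑ s, y s = ∑ n ∈ Finset.range H, ∑ s, (if layer s = n + 1 then y s else 0) := by
        rw [Finset.sum_comm]
        refine Finset.sum_congr rfl fun s _ => ?_
        have hs := hlayer s
        rw [Finset.sum_eq_single (layer s - 1)]
        · rw [if_pos (by omega)]
        · intro n _ hn
          rw [if_neg (by omega)]
        · intro hn
          rw [Finset.mem_range] at hn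
          omega
    _ ≤ ∑ n ∈ Finset.range H, ∑ s, d s := by
        refine Finset.sum_le_sum fun n _ => (key n).trans (Finset.sum_le_sum fun s _ => ?_)
        split_ifs
        exacts [le_rfl, hd s]
    _ = H * ∑ s, d s := by simp

lemma occupancy_nonneg {S A : Type*} [Fintype S] [Fintype A] {layer : S → ℕ}
    (hlayer : ∀ s, 1 ≤ layer s) {s1 : S} (hs1 : ∀ s, layer s = 1 → s = s1)
    {P : S → A → S → ℝ} (hP_nonneg : ∀ s a s', 0 ≤ P s a s')
    (hP_supp : ∀ s a s', P s a s' ≠ 0 → layer s' = layer s + 1)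
    {π : S → A → ℝ} (hπ_nonneg : ∀ s a, 0 ≤ π s a) {x : S → A → ℝ}
    (hx_init : ∀ a, x s1 a = π s1 a)
    (hx_rec : ∀ s' a', 2 ≤ layer s' → x s' a' = π s' a' * ∑ s, ∑ a, P s a s' * x s a)
    (s : S) (a : A) : 0 ≤ x s a := by
  have key : ∀ n s a, layer s = n + 1 → 0 ≤ x s a := by
    intro n
    induction n with
    | zero =>
      intro s a h
      rw [hs1 s h, hx_init]
      exact hπ_nonneg _ _
    | succ n ih =>
      intro s' a' h
      rw [hx_rec s' a' (by omega)]
      refine mul_nonneg (hπ_nonneg _ _) (Finset.sum_nonneg fun s _ => Finset.sum_nonneg fun a _ => ?_)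
      by_cases hP : P s a s' = 0
      · simp [hP]
      · have := hP_supp s a s' hP
        exact mul_nonneg (hP_nonneg _ _ _) (ih s a (by omega))
  have := hlayer s
  exact key (layer s - 1) s a (by omega)

lemma sum_transition_le_one {S A : Type*} [Fintype S] {H : ℕ} {layer : S → ℕ}
    (hlayer : ∀ s, layer s ≤ H) {P : S → A → S → ℝ}
    (hP_supp : ∀ s a s', P s a s' ≠ 0 → layer s' = layer s + 1)
    (hP_sum : ∀ s a, layer s < H → ∑ s', P s a s' = 1) (s : S) (a : A) :
    ∑ s', P s a s' ≤ 1 := by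
  rcases lt_or_ge (layer s) H with h | h
  · exact (hP_sum s a h).le
  · rw [Finset.sum_eq_zero fun s' _ => ?_]
    · exact zero_le_one
    · by_contra hne
      have := hP_supp s a s' hne
      have := hlayer s'
      omega

lemma sum_eq_add_sum_filter_ne {A : Type*} [Fintype A] [DecidableEq A] (f : A → ℝ) (b : A) :
    ∑ a, f a = f b + ∑ a ∈ Finset.univ.filter (fun a => a ≠ b), f a := by
  rw [Finset.filter_ne', Finset.add_sum_erase _ _ (Finset.mem_univ b)]

theorem stmt_9
    {S A : Type*} [Fintype S] [Fintype A] [Nonempty S] [Nonempty A]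
    [DecidableEq S] [DecidableEq A]
    (H : ℕ) (hH : 1 ≤ H)
    (layer : S → ℕ)
    (hlayer : ∀ s : S, 1 ≤ layer s ∧ layer s ≤ H)
    (hlayer_ne : ∀ h : ℕ, 1 ≤ h → h ≤ H → ∃ s : S, layer s = h)
    (s1 : S) (hs1 : ∀ s : S, (layer s = 1 ↔ s = s1))
    (P : S → A → S → ℝ)
    (hP_nonneg : ∀ s a s', 0 ≤ P s a s')
    (hP_supp : ∀ s a s', P s a s' ≠ 0 → layer s' = layer s + 1)
    (hP_sum : ∀ s a, layer s < H → ∑ s', P s a s' = 1)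
    (π : S → A → ℝ)
    (hπ_nonneg : ∀ s a, 0 ≤ π s a)
    (hπ_sum : ∀ s, ∑ a, π s a = 1)
    (x : S → A → ℝ)
    (hx_init : ∀ a, x s1 a = π s1 a)
    (hx_rec : ∀ s' a', 2 ≤ layer s' → x s' a' = π s' a' * ∑ s, ∑ a, P s a s' * x s a)
    (πd : S → A)
    (ρ : S → A → ℝ)
    (hρ_init : ∀ a, ρ s1 a = if a = πd s1 then (1:ℝ) else 0)
    (hρ_rec : ∀ s' a', 2 ≤ layer s' →
      ρ s' a' = (if a' = πd s' then (1:ℝ) else 0) * ∑ s, ∑ a, P s a s' * ρ s a)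
    (α : ℝ) (hα1 : 1 < α) (hα2 : α ≤ 2) :
    (∑ s, ∑ a, x s a ^ (1/α)) - (∑ s, ∑ a, ρ s a ^ (1/α)) ≤
      (1 + (H : ℝ) ^ (1/α) * (Fintype.card S : ℝ) ^ (1 - 1/α)) *
        ∑ s, ∑ a ∈ Finset.univ.filter (fun a => a ≠ πd s), x s a ^ (1/α) := by
  have hp : 0 < 1 / α := by positivity
  have hp1 : 1 / α ≤ 1 := (div_le_one (by linarith)).2 hα1.le
  have hπ_le : ∀ s a, π s a ≤ 1 := fun s a =>
    hπ_sum s ▸ Finset.single_le_sum (fun a _ => hπ_nonneg s a) (Finset.mem_univ a)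
  have hx : ∀ s a, 0 ≤ x s a := occupancy_nonneg (fun s => (hlayer s).1) (fun s => (hs1 s).1)
    hP_nonneg hP_supp hπ_nonneg hx_init hx_rec
  have hρ : ∀ s a, 0 ≤ ρ s a := occupancy_nonneg (fun s => (hlayer s).1) (fun s => (hs1 s).1)
    hP_nonneg hP_supp (π := fun s a => if a = πd s then (1 : ℝ) else 0)
    (fun s a => by split_ifs <;> norm_num) hρ_init hρ_rec
  have hρ_off : ∀ s a, a ≠ πd s → ρ s a = 0 := by
    intro s a ha
    rcases eq_or_ne (layer s) 1 with h | h
    · obtain rfl := (hs1 s).1 h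
      rw [hρ_init, if_neg ha]
    · have := (hlayer s).1
      rw [hρ_rec s a (by omega), if_neg ha, zero_mul]
  set y : S → ℝ := fun s => max 0 (x s (πd s) - ρ s (πd s)) with hy_def
  have hy_nonneg : ∀ s, 0 ≤ y s := fun s => le_max_left _ _
  set d : S → ℝ := fun s => ∑ a ∈ Finset.univ.filter (fun a => a ≠ πd s), x s a with hd_def
  have hd_nonneg : ∀ s, 0 ≤ d s := fun s => Finset.sum_nonneg fun a _ => hx s a
  set g : S → S → ℝ := fun s s' => P s (πd s) s' * y s +
    ∑ a ∈ Finset.univ.filter (fun a => a ≠ πd s), P s a s' * x s a with hg_def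
  have hg_nonneg : ∀ s s', 0 ≤ g s s' := fun s s' =>
    add_nonneg (mul_nonneg (hP_nonneg _ _ _) (hy_nonneg s))
      (Finset.sum_nonneg fun a _ => mul_nonneg (hP_nonneg _ _ _) (hx s a))
  have hP_le := sum_transition_le_one (fun s => (hlayer s).2) hP_supp hP_sum
  have hflow : ∑ s, y s ≤ H * ∑ s, d s := by
    refine sum_le_mul_sum_of_layered_flow hlayer (g := g) hd_nonneg ?_ ?_ hg_nonneg ?_ ?_
    · intro s hs
      obtain rfl := (hs1 s).1 hs
      simp only [hy_def, hx_init, hρ_init, if_true]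
      exact max_le le_rfl (by linarith [hπ_le s (πd s)])
    · intro s s' hne
      by_contra hl
      have hP0 : ∀ a, P s a s' = 0 := fun a => by
        by_contra h
        exact hl (hP_supp s a s' h)
      exact hne (by simp [hg_def, hP0])
    · intro s
      simp only [hg_def, hd_def]
      rw [Finset.sum_add_distrib, ← Finset.sum_mul, Finset.sum_comm]
      refine add_le_add (mul_le_of_le_one_left (hy_nonneg s) (hP_le s _))
        (Finset.sum_le_sum fun a _ => ?_)
      rw [← Finset.sum_mul]
      exact mul_le_of_le_one_left (hx s a) (hP_le s a)
    · intro s' hs'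
      refine max_le (Finset.sum_nonneg fun s _ => hg_nonneg s s') ?_
      have hin : 0 ≤ ∑ s, ∑ a, P s a s' * x s a := Finset.sum_nonneg fun s _ =>
        Finset.sum_nonneg fun a _ => mul_nonneg (hP_nonneg _ _ _) (hx s a)
      rw [hx_rec s' _ hs', hρ_rec s' _ hs', if_pos rfl, one_mul]
      refine (sub_le_sub_right (mul_le_of_le_one_left hin (hπ_le s' _)) _).trans ?_
      rw [← Finset.sum_sub_distrib]
      refine Finset.sum_le_sum fun s _ => ?_
      have hρ_sum : ∑ a, P s a s' * ρ s a = P s (πd s) s' * ρ s (πd s) :=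
        Finset.sum_eq_single _ (fun a _ ha => by rw [hρ_off s a ha, mul_zero]) (by simp)
      rw [hρ_sum, sum_eq_add_sum_filter_ne (fun a => P s a s' * x s a) (πd s), add_sub_right_comm,
        ← mul_sub]
      exact add_le_add_left
        (mul_le_mul_of_nonneg_left (le_max_right _ _) (hP_nonneg _ _ _)) _
  set D := ∑ s, ∑ a ∈ Finset.univ.filter (fun a => a ≠ πd s), x s a ^ (1 / α) with hD_def
  have hdD : (∑ s, d s) ^ (1 / α) ≤ D :=
    (rpow_sum_le_sum_rpow_of_le_one _ hp hp1 d fun s _ => hd_nonneg s).trans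
      (Finset.sum_le_sum fun s _ => rpow_sum_le_sum_rpow_of_le_one _ hp hp1 _ fun a _ => hx s a)
  have hyD : ∑ s, y s ^ (1 / α) ≤
      (H : ℝ) ^ (1 / α) * (Fintype.card S : ℝ) ^ (1 - 1 / α) * D := by
    have hd_sum : 0 ≤ ∑ s, d s := Finset.sum_nonneg fun s _ => hd_nonneg s
    calc ∑ s, y s ^ (1 / α)
        ≤ (Fintype.card S : ℝ) ^ (1 - 1 / α) * (∑ s, y s) ^ (1 / α) :=
          sum_rpow_le_card_rpow_mul_rpow_sum hα1.le y hy_nonneg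
      _ ≤ (Fintype.card S : ℝ) ^ (1 - 1 / α) * (H * ∑ s, d s) ^ (1 / α) := by
          have := Finset.sum_nonneg fun s (_ : s ∈ Finset.univ) => hy_nonneg s
          gcongr
      _ = (H : ℝ) ^ (1 / α) * (Fintype.card S : ℝ) ^ (1 - 1 / α) * (∑ s, d s) ^ (1 / α) := by
          rw [Real.mul_rpow (by positivity) hd_sum]
          ring
      _ ≤ _ := by gcongr
  have hx_split : ∑ s, ∑ a, x s a ^ (1 / α) = ∑ s, x s (πd s) ^ (1 / α) + D := by
    rw [hD_def, ← Finset.sum_add_distrib]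
    exact Finset.sum_congr rfl fun s _ => sum_eq_add_sum_filter_ne (fun a => x s a ^ (1 / α)) (πd s)
  have hρ_split : ∑ s, ∑ a, ρ s a ^ (1 / α) = ∑ s, ρ s (πd s) ^ (1 / α) :=
    Finset.sum_congr rfl fun s _ => Finset.sum_eq_single _
      (fun a _ ha => by rw [hρ_off s a ha, Real.zero_rpow hp.ne']) (by simp)
  have hdiff : ∑ s, x s (πd s) ^ (1 / α) - ∑ s, ρ s (πd s) ^ (1 / α) ≤ ∑ s, y s ^ (1 / α) := by
    rw [← Finset.sum_sub_distrib]
    exact Finset.sum_le_sum fun s _ => rpow_sub_rpow_le_rpow_max_sub (hx _ _) (hρ _ _) hp.le hp1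
  rw [hx_split, hρ_split]
  linarith
end

section
/- Skipping-error bound: in the layered MDP with random losses, let π̊ be a deterministic policy with occupancy measure ρ̊ = ρ^{ℙ,π̊}, and define the skipping bonus b^{skip}(s,a) = C^{1−α} σ t^{1/α − 1} x(s,a)^{1/α − 1}. Then 𝔼[ ∑_{(s,a)} (x(s,a) − ρ̊(s,a)) · ( ℓ(s,a) − ℓ^{skip}(s,a) + b^{skip}(s,a) ) ] ≤ 2 C^{1−α} (1 + H^{1/α} S^{1 − 1/α}) · σ t^{1/α − 1} · ∑_{(s,a): a ≠ π̊(s)} x(s,a)^{1/α}. -/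
open Finset MeasureTheory

open scoped Classical

/-- Subadditivity of `y ↦ y ^ p` for `p ∈ [0, 1]` over a finite sum. -/
lemma rpow_sum_le_sum_rpow {ι : Type*} (s : Finset ι) (f : ι → ℝ) (hf : ∀ i, 0 ≤ f i)
    {p : ℝ} (hp0 : 0 < p) (hp1 : p ≤ 1) : (∑ i ∈ s, f i) ^ p ≤ ∑ i ∈ s, f i ^ p := by
  induction s using Finset.induction_on with
  | empty => simp [Real.zero_rpow hp0.ne']
  | insert i s hi ih =>
    rw [sum_insert hi, sum_insert hi]
    exact (Real.rpow_add_le_add_rpow (hf i) (sum_nonneg fun j _ => hf j) hp0.le hp1).trans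
      (by gcongr)

/-- Hölder's inequality against the constant function `1`, for the exponent `1 / α`. -/
lemma sum_rpow_one_div_le {ι : Type*} [Fintype ι] (f : ι → ℝ) (hf : ∀ i, 0 ≤ f i)
    {α : ℝ} (hα : 1 ≤ α) :
    ∑ i, f i ^ (1 / α) ≤ (Fintype.card ι : ℝ) ^ (1 - 1 / α) * (∑ i, f i) ^ (1 / α) := by
  have hα0 : 0 < α := by linarith
  have h := Real.rpow_sum_le_const_mul_sum_rpow_of_nonneg (s := univ)
    (f := fun i => f i ^ (1 / α)) hα (fun i _ => Real.rpow_nonneg (hf i) _)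
  have hpow : ∀ y : ℝ, 0 ≤ y → (y ^ (1 / α)) ^ α = y := fun y hy => by
    rw [← Real.rpow_mul hy, one_div_mul_cancel hα0.ne', Real.rpow_one]
  simp only [hpow _ (hf _), card_univ] at h
  have hsum : 0 ≤ ∑ i, f i ^ (1 / α) := sum_nonneg fun i _ => Real.rpow_nonneg (hf i) _
  have h' := Real.rpow_le_rpow (Real.rpow_nonneg hsum _) h (z := 1 / α) (by positivity)
  rw [← Real.rpow_mul hsum, mul_one_div_cancel hα0.ne', Real.rpow_one,
    Real.mul_rpow (by positivity) (sum_nonneg fun i _ => hf i), ← Real.rpow_mul (by positivity)]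
    at h'
  have he : (α - 1) * (1 / α) = 1 - 1 / α := by field_simp
  rwa [he] at h'

/-- In a layered flow in which every state passes on at most its own mass `D` plus a source `G`,
and the first layer carries no mass, the total mass is at most `H` times the total source. -/
lemma sum_layered_flow_le {S : Type*} [Fintype S] (H : ℕ) (layer : S → ℕ)
    (hlayer : ∀ s, 1 ≤ layer s ∧ layer s ≤ H) (Q : S → S → ℝ) (D G : S → ℝ)
    (hQ : ∀ s s', 0 ≤ Q s s') (hQ_supp : ∀ s s', Q s s' ≠ 0 → layer s' = layer s + 1)
    (hG : ∀ s, 0 ≤ G s) (hD_init : ∀ s, layer s = 1 → D s ≤ 0)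
    (hD_in : ∀ s', 2 ≤ layer s' → D s' ≤ ∑ s, Q s s')
    (hQ_out : ∀ s, ∑ s', Q s s' ≤ D s + G s) :
    ∑ s, D s ≤ H * ∑ s, G s := by
  have key : ∀ h : ℕ, ∑ s with layer s = h + 1, D s ≤ ∑ s with layer s < h + 1, G s := by
    intro h
    induction h with
    | zero =>
      refine (sum_nonpos fun s hs => hD_init s ?_).trans (sum_nonneg fun s _ => hG s)
      simpa using hs
    | succ h ih =>
      have hzero : ∀ s, layer s ≠ h + 1 → ∑ s' with layer s' = h + 1 + 1, Q s s' = 0 := by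
        intro s hs
        refine sum_eq_zero fun s' hs' => ?_
        by_contra hne
        have h1 := hQ_supp s s' hne
        have h2 := (mem_filter.mp hs').2
        omega
      calc ∑ s' with layer s' = h + 1 + 1, D s'
          ≤ ∑ s' with layer s' = h + 1 + 1, ∑ s, Q s s' :=
            sum_le_sum fun s' hs' => hD_in s' (by have := (mem_filter.mp hs').2; omega)
        _ = ∑ s, ∑ s' with layer s' = h + 1 + 1, Q s s' := sum_comm
        _ = ∑ s with layer s = h + 1, ∑ s' with layer s' = h + 1 + 1, Q s s' := by
            rw [sum_filter (fun s => layer s = h + 1)]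
            refine sum_congr rfl fun s _ => ?_
            split_ifs with hs
            · rfl
            · exact hzero s hs
        _ ≤ ∑ s with layer s = h + 1, (D s + G s) :=
            sum_le_sum fun s _ =>
              (sum_le_univ_sum_of_nonneg fun s' => hQ s s').trans (hQ_out s)
        _ ≤ (∑ s with layer s < h + 1, G s) + ∑ s with layer s = h + 1, G s := by
            rw [sum_add_distrib]
            gcongr
        _ = ∑ s with layer s < h + 1 + 1, G s := by
            simp only [sum_filter, ← sum_add_distrib]
            refine sum_congr rfl fun s _ => ?_
            split_ifs <;> first | omega | simp
  have hmaps : ∀ s ∈ (univ : Finset S), layer s - 1 ∈ range H := fun s _ => by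
    have := hlayer s
    simp only [mem_range]
    omega
  rw [← sum_fiberwise_of_maps_to hmaps]
  calc ∑ h ∈ range H, ∑ s with layer s - 1 = h, D s
      ≤ ∑ _h ∈ range H, ∑ s, G s := by
        refine sum_le_sum fun h _ => ?_
        have heq : (univ.filter fun s => layer s - 1 = h) = univ.filter fun s => layer s = h + 1 :=
          filter_congr fun s _ => by have := hlayer s; omega
        rw [heq]
        exact (key h).trans (sum_le_univ_sum_of_nonneg hG)
    _ = H * ∑ s, G s := by simp

/-- Markov-type bound on the part of `z` beyond the level `τ`. -/
lemma abs_sub_truncation_le {α τ : ℝ} (hα : 1 ≤ α) (hτ : 0 < τ) (z : ℝ) :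
    |z - (if |z| ≤ τ then z else 0)| ≤ τ ^ (1 - α) * |z| ^ α := by
  split_ifs with h
  · rw [sub_self, abs_zero]
    positivity
  · push Not at h
    have hz : 0 < |z| := hτ.trans h
    rw [sub_zero]
    calc |z| = |z| ^ (1 - α) * |z| ^ α := by rw [← Real.rpow_add hz]; simp
      _ ≤ τ ^ (1 - α) * |z| ^ α := by
        gcongr ?_ * _
        exact Real.rpow_le_rpow_of_nonpos hτ h.le (by linarith)

lemma integrable_sub_truncation {α τ : ℝ} (hα : 1 ≤ α) (hτ : 0 < τ) {μ : Measure ℝ}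
    (hμ : Integrable (fun z : ℝ => |z| ^ α) μ) :
    Integrable (fun z : ℝ => z - (if |z| ≤ τ then z else 0)) μ := by
  have hmeas : Measurable (fun z : ℝ => z - (if |z| ≤ τ then z else 0)) := by
    refine measurable_id.sub (Measurable.ite ?_ measurable_id measurable_const)
    exact measurableSet_le (by fun_prop) measurable_const
  exact (hμ.const_mul (τ ^ (1 - α))).mono' hmeas.aestronglyMeasurable
    (ae_of_all _ fun z => abs_sub_truncation_le hα hτ z)

lemma abs_integral_sub_truncation_le {α τ : ℝ} (hα : 1 ≤ α) (hτ : 0 < τ) {μ : Measure ℝ}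
    (hμ : Integrable (fun z : ℝ => |z| ^ α) μ) :
    |∫ z : ℝ, (z - (if |z| ≤ τ then z else 0)) ∂μ| ≤ τ ^ (1 - α) * ∫ z : ℝ, |z| ^ α ∂μ := by
  rw [← integral_const_mul, ← Real.norm_eq_abs]
  refine norm_integral_le_of_norm_le (hμ.const_mul _) (ae_of_all _ fun z => ?_)
  exact abs_sub_truncation_le hα hτ z

/-- At the level `C σ t^{1/α} x^{1/α}` the Markov bound is the skipping bonus. -/
lemma level_rpow_mul {α σ C t x : ℝ} (hα : 0 < α) (hσ : 0 < σ) (hC : 0 < C) (ht : 0 < t)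
    (hx : 0 < x) :
    (C * σ * t ^ (1 / α) * x ^ (1 / α)) ^ (1 - α) * σ ^ α =
      C ^ (1 - α) * σ * t ^ (1 / α - 1) * x ^ (1 / α - 1) := by
  have he : 1 / α * (1 - α) = 1 / α - 1 := by field_simp
  have hσ' : σ ^ (1 - α) * σ ^ α = σ := by rw [← Real.rpow_add hσ]; simp
  rw [Real.mul_rpow (by positivity) (by positivity), Real.mul_rpow (by positivity) (by positivity),
    Real.mul_rpow hC.le hσ.le, ← Real.rpow_mul ht.le, ← Real.rpow_mul hx.le, he]
  linear_combination C ^ (1 - α) * t ^ (1 / α - 1) * x ^ (1 / α - 1) * hσ'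

/-- Occupancy measures of a layered process are nonnegative. -/
lemma occupancy_nonneg_s11 {S A : Type*} [Fintype S] [Fintype A] (layer : S → ℕ)
    (P : S → A → S → ℝ) (hP : ∀ s a s', 0 ≤ P s a s')
    (hP_supp : ∀ s a s', P s a s' ≠ 0 → layer s' = layer s + 1)
    (π : S → A → ℝ) (hπ : ∀ s a, 0 ≤ π s a) (ρ : S → A → ℝ)
    (hρ_init : ∀ s a, layer s < 2 → 0 ≤ ρ s a)
    (hρ_rec : ∀ s' a', 2 ≤ layer s' → ρ s' a' = π s' a' * ∑ s, ∑ a, P s a s' * ρ s a) :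
    ∀ s a, 0 ≤ ρ s a := by
  have key : ∀ n s, layer s = n → ∀ a, 0 ≤ ρ s a := by
    intro n
    induction n with
    | zero => exact fun s hs a => hρ_init s a (by omega)
    | succ n ih =>
      intro s' hs' a'
      by_cases h2 : 2 ≤ layer s'
      · rw [hρ_rec s' a' h2]
        refine mul_nonneg (hπ _ _) (sum_nonneg fun s _ => sum_nonneg fun a _ => ?_)
        by_cases hzero : P s a s' = 0
        · simp [hzero]
        · have := hP_supp s a s' hzero
          exact mul_nonneg (hP _ _ _) (ih s (by omega) a)
      · exact hρ_init s' a' (by omega)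
  exact fun s => key _ s rfl

/-- The mass lost by the reference policy along its own trajectory, in terms of the mass that the
other policy puts on deviating actions. -/
lemma sum_posPart_occupancy_sub_le
    {S A : Type*} [Fintype S] [Fintype A] [DecidableEq A]
    (H : ℕ) (layer : S → ℕ) (hlayer : ∀ s : S, 1 ≤ layer s ∧ layer s ≤ H)
    (P : S → A → S → ℝ) (hP : ∀ s a s', 0 ≤ P s a s')
    (hP_supp : ∀ s a s', P s a s' ≠ 0 → layer s' = layer s + 1)
    (hP_sum : ∀ s a, ∑ s', P s a s' ≤ 1)
    (x ρ : S → A → ℝ) (hx : ∀ s a, 0 ≤ x s a) (πd : S → A)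
    (h_init : ∀ s, layer s = 1 → x s (πd s) ≤ ρ s (πd s))
    (hx_in : ∀ s', 2 ≤ layer s' → x s' (πd s') ≤ ∑ s, ∑ a, P s a s' * x s a)
    (hρ_in : ∀ s', 2 ≤ layer s' → ρ s' (πd s') = ∑ s, P s (πd s) s' * ρ s (πd s)) :
    ∑ s, max (x s (πd s) - ρ s (πd s)) 0 ≤
      H * ∑ s, ∑ a ∈ univ.filter (fun a => a ≠ πd s), x s a := by
  have hsplit : ∀ (s : S) (f : A → ℝ),
      ∑ a, f a = f (πd s) + ∑ a ∈ univ.filter (fun a => a ≠ πd s), f a := fun s f => by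
    rw [filter_ne', add_sum_erase _ _ (mem_univ _)]
  refine sum_layered_flow_le H layer hlayer
    (fun s s' => P s (πd s) s' * max (x s (πd s) - ρ s (πd s)) 0 +
      ∑ a ∈ univ.filter (fun a => a ≠ πd s), P s a s' * x s a) _ _ ?_ ?_ ?_ ?_ ?_ ?_
  · exact fun s s' => add_nonneg (mul_nonneg (hP _ _ _) (le_max_right _ _))
      (sum_nonneg fun a _ => mul_nonneg (hP _ _ _) (hx _ _))
  · intro s s' hne
    by_contra hl
    have hzero : ∀ a, P s a s' = 0 := fun a => by
      by_contra h
      exact hl (hP_supp s a s' h)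
    simp [hzero] at hne
  · exact fun s => sum_nonneg fun a _ => hx s a
  · exact fun s hs => max_le (by linarith [h_init s hs]) le_rfl
  · intro s' hs'
    refine max_le ?_ (sum_nonneg fun s _ => ?_)
    · have h := hx_in s' hs'
      rw [hρ_in s' hs']
      refine (sub_le_sub_right h _).trans ?_
      rw [← sum_sub_distrib]
      refine sum_le_sum fun s _ => ?_
      rw [hsplit s]
      have := mul_le_mul_of_nonneg_left (le_max_left (x s (πd s) - ρ s (πd s)) 0) (hP s (πd s) s')
      linarith
    · exact add_nonneg (mul_nonneg (hP _ _ _) (le_max_right _ _))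
        (sum_nonneg fun a _ => mul_nonneg (hP _ _ _) (hx _ _))
  · intro s
    rw [sum_add_distrib, ← sum_mul, sum_comm]
    refine add_le_add (mul_le_of_le_one_left (le_max_right _ _) (hP_sum _ _))
      (sum_le_sum fun a _ => ?_)
    rw [← sum_mul]
    exact mul_le_of_le_one_left (hx _ _) (hP_sum _ _)

/-- If `m` is bounded by `b` in absolute value then `y (m + b) ≤ 2 b y⁺`. -/
lemma mul_add_le_two_mul_max {y m b : ℝ} (hm : |m| ≤ b) : y * (m + b) ≤ 2 * b * max y 0 := by
  obtain ⟨h1, h2⟩ := abs_le.mp hm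
  calc y * (m + b) ≤ max y 0 * (m + b) :=
        mul_le_mul_of_nonneg_right (le_max_left _ _) (by linarith)
    _ ≤ max y 0 * (2 * b) := mul_le_mul_of_nonneg_left (by linarith) (le_max_right _ _)
    _ = 2 * b * max y 0 := mul_comm _ _

lemma max_mul_rpow_sub_one_le {d x p : ℝ} (hd : d ≤ x) (hp0 : 0 < p) (hp1 : p ≤ 1) :
    max d 0 * x ^ (p - 1) ≤ max d 0 ^ p := by
  rcases le_or_gt d 0 with h | h
  · simp [max_eq_right h, Real.zero_rpow hp0.ne']
  · rw [max_eq_left h.le]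
    calc d * x ^ (p - 1) ≤ d * d ^ (p - 1) :=
          mul_le_mul_of_nonneg_left (Real.rpow_le_rpow_of_nonpos h hd (by linarith)) h.le
      _ = d ^ p := by rw [mul_comm, ← Real.rpow_add_one h.ne']; simp

theorem stmt_11
    {S A : Type*} [Fintype S] [Fintype A] [Nonempty S] [Nonempty A]
    [DecidableEq S] [DecidableEq A]
    (H : ℕ) (hH : 1 ≤ H)
    (layer : S → ℕ)
    (hlayer : ∀ s : S, 1 ≤ layer s ∧ layer s ≤ H)
    (hlayer_ne : ∀ h : ℕ, 1 ≤ h → h ≤ H → ∃ s : S, layer s = h)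
    (s1 : S) (hs1 : ∀ s : S, (layer s = 1 ↔ s = s1))
    (P : S → A → S → ℝ)
    (hP_nonneg : ∀ s a s', 0 ≤ P s a s')
    (hP_supp : ∀ s a s', P s a s' ≠ 0 → layer s' = layer s + 1)
    (hP_sum : ∀ s a, layer s < H → ∑ s', P s a s' = 1)
    (π : S → A → ℝ)
    (hπ_nonneg : ∀ s a, 0 ≤ π s a)
    (hπ_sum : ∀ s, ∑ a, π s a = 1)
    (x : S → A → ℝ)
    (hx_init : ∀ a, x s1 a = π s1 a)
    (hx_rec : ∀ s' a', 2 ≤ layer s' → x s' a' = π s' a' * ∑ s, ∑ a, P s a s' * x s a)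
    (hx_pos : ∀ s a, 0 < x s a)
    (πd : S → A)
    (ρ : S → A → ℝ)
    (hρ_init : ∀ a, ρ s1 a = if a = πd s1 then (1:ℝ) else 0)
    (hρ_rec : ∀ s' a', 2 ≤ layer s' →
      ρ s' a' = (if a' = πd s' then (1:ℝ) else 0) * ∑ s, ∑ a, P s a s' * ρ s a)
    (α σ C t : ℝ)
    (hα1 : 1 < α) (hα2 : α ≤ 2) (hσ : 0 < σ) (hC : 0 < C) (ht : 1 ≤ t)
    (ν : S × A → Measure ℝ)
    (hν_prob : ∀ sa, IsProbabilityMeasure (ν sa))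
    (hν_int : ∀ sa, Integrable (fun z : ℝ => |z| ^ α) (ν sa))
    (hν_mom : ∀ sa, (∫ z : ℝ, |z| ^ α ∂(ν sa)) ≤ σ ^ α) :
    (∫ (L : (S × A) → ℝ),
        (∑ s, ∑ a, (x s a - ρ s a) *
          (L (s, a) - (if |L (s, a)| ≤ C * σ * t ^ (1/α) * x s a ^ (1/α) then L (s, a) else 0) +
            C ^ (1 - α) * σ * t ^ (1/α - 1) * x s a ^ (1/α - 1)))
        ∂(Measure.pi fun sa => ν sa)) ≤
      2 * C ^ (1 - α) * (1 + (H : ℝ) ^ (1/α) * (Fintype.card S : ℝ) ^ (1 - 1/α)) * σ *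
        t ^ (1/α - 1) * ∑ s, ∑ a ∈ Finset.univ.filter (fun a => a ≠ πd s), x s a ^ (1/α) := by
  have hα0 : 0 < α := by linarith
  have ht0 : 0 < t := by linarith
  have hp0 : 0 < 1 / α := by positivity
  have hp1 : 1 / α ≤ 1 := by rw [div_le_one hα0]; exact hα1.le
  have hx0 : ∀ s a, 0 ≤ x s a := fun s a => (hx_pos s a).le
  have hρ0 : ∀ s a, 0 ≤ ρ s a := by
    refine occupancy_nonneg_s11 layer P hP_nonneg hP_supp
      (fun s a => if a = πd s then (1 : ℝ) else 0) (fun s a => by positivity) ρ ?_ hρ_rec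
    intro s a hs
    have := hlayer s
    rw [(hs1 s).mp (by omega), hρ_init]
    positivity
  have hρ_ne : ∀ s a, a ≠ πd s → ρ s a = 0 := by
    intro s a ha
    by_cases h2 : 2 ≤ layer s
    · rw [hρ_rec s a h2, if_neg ha, zero_mul]
    · have := hlayer s
      have hs := (hs1 s).mp (by omega)
      subst hs
      rw [hρ_init, if_neg ha]
  have hπ_le : ∀ s a, π s a ≤ 1 := fun s a => by
    rw [← hπ_sum s]
    exact single_le_sum (fun b _ => hπ_nonneg s b) (mem_univ a)
  have hP_le : ∀ s a, ∑ s', P s a s' ≤ 1 := by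
    intro s a
    by_cases hs : layer s < H
    · exact (hP_sum s a hs).le
    · refine (sum_eq_zero fun s' _ => ?_).trans_le zero_le_one
      by_contra hne
      have h1 := hP_supp s a s' hne
      have h2 := hlayer s'
      omega
  have hdev : ∑ s, max (x s (πd s) - ρ s (πd s)) 0 ≤
      H * ∑ s, ∑ a ∈ univ.filter (fun a => a ≠ πd s), x s a := by
    refine sum_posPart_occupancy_sub_le H layer hlayer P hP_nonneg hP_supp hP_le x ρ hx0 πd
      ?_ ?_ ?_
    · intro s hs
      have hs := (hs1 s).mp hs
      subst hs
      rw [hx_init, hρ_init, if_pos rfl]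
      exact hπ_le _ _
    · intro s' hs'
      rw [hx_rec s' _ hs']
      exact mul_le_of_le_one_left (sum_nonneg fun s _ => sum_nonneg fun a _ =>
        mul_nonneg (hP_nonneg _ _ _) (hx0 _ _)) (hπ_le _ _)
    · intro s' hs'
      rw [hρ_rec s' _ hs', if_pos rfl, one_mul]
      refine sum_congr rfl fun s _ => ?_
      rw [sum_eq_single (πd s)]
      · exact fun a _ ha => by rw [hρ_ne s a ha, mul_zero]
      · simp
  set W := ∑ s, ∑ a ∈ univ.filter (fun a => a ≠ πd s), x s a ^ (1 / α) with hW
  have hW_sub : (∑ s, ∑ a ∈ univ.filter (fun a => a ≠ πd s), x s a) ^ (1 / α) ≤ W :=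
    (rpow_sum_le_sum_rpow _ _ (fun s => sum_nonneg fun a _ => hx0 s a) hp0 hp1).trans
      (sum_le_sum fun s _ => rpow_sum_le_sum_rpow _ _ (hx0 s) hp0 hp1)
  have hdiag : ∑ s, max (x s (πd s) - ρ s (πd s)) 0 ^ (1 / α) ≤
      (H : ℝ) ^ (1 / α) * (Fintype.card S : ℝ) ^ (1 - 1 / α) * W := by
    refine (sum_rpow_one_div_le _ (fun s => le_max_right _ _) hα1.le).trans ?_
    calc (Fintype.card S : ℝ) ^ (1 - 1 / α) *
          (∑ s, max (x s (πd s) - ρ s (πd s)) 0) ^ (1 / α)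
        ≤ (Fintype.card S : ℝ) ^ (1 - 1 / α) *
          (H * ∑ s, ∑ a ∈ univ.filter (fun a => a ≠ πd s), x s a) ^ (1 / α) := by
          gcongr
      _ ≤ (Fintype.card S : ℝ) ^ (1 - 1 / α) * ((H : ℝ) ^ (1 / α) * W) := by
          rw [Real.mul_rpow (by positivity)
            (sum_nonneg fun s _ => sum_nonneg fun a _ => hx0 s a)]
          gcongr
      _ = (H : ℝ) ^ (1 / α) * (Fintype.card S : ℝ) ^ (1 - 1 / α) * W := by ring
  have hdet : ∑ s, ∑ a, max (x s a - ρ s a) 0 * x s a ^ (1 / α - 1) ≤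
      (1 + (H : ℝ) ^ (1 / α) * (Fintype.card S : ℝ) ^ (1 - 1 / α)) * W := by
    calc ∑ s, ∑ a, max (x s a - ρ s a) 0 * x s a ^ (1 / α - 1)
        ≤ ∑ s, ∑ a, max (x s a - ρ s a) 0 ^ (1 / α) :=
          sum_le_sum fun s _ => sum_le_sum fun a _ =>
            max_mul_rpow_sub_one_le (by linarith [hρ0 s a]) hp0 hp1
      _ = ∑ s, max (x s (πd s) - ρ s (πd s)) 0 ^ (1 / α) + W := by
          rw [hW, ← sum_add_distrib]
          refine sum_congr rfl fun s _ => ?_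
          rw [filter_ne', ← add_sum_erase _ _ (mem_univ (πd s))]
          congr 1
          refine sum_congr rfl fun a ha => ?_
          rw [hρ_ne s a (ne_of_mem_erase ha), sub_zero, max_eq_left (hx0 s a)]
      _ ≤ _ := by linarith
  have hτ : ∀ s a, 0 < C * σ * t ^ (1 / α) * x s a ^ (1 / α) := fun s a => by
    have := hx_pos s a
    positivity
  have hint : ∀ s a, Integrable (fun L : S × A → ℝ =>
      L (s, a) - (if |L (s, a)| ≤ C * σ * t ^ (1/α) * x s a ^ (1/α) then L (s, a) else 0))
      (Measure.pi fun sa => ν sa) := fun s a =>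
    (measurePreserving_eval ν (s, a)).integrable_comp_of_integrable
      (integrable_sub_truncation hα1.le (hτ s a) (hν_int (s, a)))
  have hmean : ∀ s a, |∫ L : S × A → ℝ,
      (L (s, a) - (if |L (s, a)| ≤ C * σ * t ^ (1/α) * x s a ^ (1/α) then L (s, a) else 0))
      ∂(Measure.pi fun sa => ν sa)| ≤
        C ^ (1 - α) * σ * t ^ (1/α - 1) * x s a ^ (1/α - 1) := by
    intro s a
    have hmp := measurePreserving_eval ν (s, a)
    have hi := integrable_sub_truncation hα1.le (hτ s a) (hν_int (s, a))
    have heq := integral_map hmp.measurable.aemeasurable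
      (hmp.map_eq.symm ▸ hi.aestronglyMeasurable)
    rw [hmp.map_eq] at heq
    simp only [Function.eval] at heq
    rw [← heq, ← level_rpow_mul hα0 hσ hC ht0 (hx_pos s a)]
    exact (abs_integral_sub_truncation_le hα1.le (hτ s a) (hν_int (s, a))).trans
      (mul_le_mul_of_nonneg_left (hν_mom (s, a)) (Real.rpow_nonneg (hτ s a).le _))
  have hterm : ∀ s a, Integrable (fun L : S × A → ℝ => (x s a - ρ s a) *
      (L (s, a) - (if |L (s, a)| ≤ C * σ * t ^ (1/α) * x s a ^ (1/α) then L (s, a) else 0) +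
        C ^ (1 - α) * σ * t ^ (1/α - 1) * x s a ^ (1/α - 1))) (Measure.pi fun sa => ν sa) :=
    fun s a => ((hint s a).add (integrable_const _)).const_mul _
  rw [integral_finsetSum _ fun s _ => integrable_finsetSum _ fun a _ => hterm s a]
  calc _ ≤ ∑ s, ∑ a, 2 * (C ^ (1 - α) * σ * t ^ (1/α - 1) * x s a ^ (1/α - 1)) *
        max (x s a - ρ s a) 0 := by
        refine sum_le_sum fun s _ => ?_
        rw [integral_finsetSum _ fun a _ => hterm s a]
        refine sum_le_sum fun a _ => ?_
        rw [integral_const_mul, integral_add (hint s a) (integrable_const _), integral_const,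
          probReal_univ, one_smul]
        exact mul_add_le_two_mul_max (hmean s a)
    _ = 2 * C ^ (1 - α) * σ * t ^ (1/α - 1) *
        ∑ s, ∑ a, max (x s a - ρ s a) 0 * x s a ^ (1 / α - 1) := by
        simp only [mul_sum]
        exact sum_congr rfl fun s _ => sum_congr rfl fun a _ => by ring
    _ ≤ 2 * C ^ (1 - α) * σ * t ^ (1/α - 1) *
        ((1 + (H : ℝ) ^ (1 / α) * (Fintype.card S : ℝ) ^ (1 - 1 / α)) * W) := by
        gcongr
    _ = _ := by ring
end
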